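/- Let U ∈ Gr_e(H), W_1 ∈ C_U, and W_2 ∈ Gr_{e+1}(H). Then |φ(W_1) ∩ [W_2]| = (q^e − 1)/(q − 1) if and only if σ(U) ⊆ W_2, where φ(W_1) = [σ(U)] ∪ ([W_1] \ [H]). -/

import Mathlib

/-- `[W]`: the set of `1`-dimensional subspaces of `V` contained in `W`. -/
def projPts {F V : Type*} [Field F] [AddCommGroup V] [Module F V]
    (W : Submodule F V) : Set (Submodule F V) :=
  {L | Module.finrank F ↥L = 1 ∧ L ≤ W}

/-- `φ(W) = [σ(W ∩ H)] ∪ ([W] \ [H])` for `W ∈ A`, where `σ` is a polarity of the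
hyperplane `H`. For `W ∈ C_U` this is `[σ(U)] ∪ ([W] \ [H])`. -/
def phiA {F V : Type*} [Field F] [AddCommGroup V] [Module F V]
    (H : Submodule F V) (σ : Submodule F ↥H → Submodule F ↥H)
    (W : Submodule F V) : Set (Submodule F V) :=
  projPts (Submodule.map H.subtype (σ (Submodule.comap H.subtype W))) ∪
    (projPts W \ projPts H)

lemma polarity_finrank {F M : Type*} [Field F] [AddCommGroup M] [Module F M]
    [FiniteDimensional F M] (σ : Submodule F M → Submodule F M)
    (hinv : ∀ U, σ (σ U) = U) (hanti : ∀ U U' : Submodule F M, U ≤ U' → σ U' ≤ σ U)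
    (U : Submodule F M) :
    Module.finrank F (σ U) + Module.finrank F U = Module.finrank F M := by
  let f : Submodule F M ≃o (Submodule F M)ᵒᵈ :=
    { toFun := fun U => OrderDual.toDual (σ U)
      invFun := fun U => σ (OrderDual.ofDual U)
      left_inv := fun U => hinv U
      right_inv := fun U => hinv U
      map_rel_iff' := by
        intro a b
        change σ b ≤ σ a ↔ a ≤ b
        constructor
        · intro h
          have := hanti _ _ h
          rwa [hinv, hinv] at this
        · intro h
          exact hanti _ _ h }
  have h1 : Order.height (f U) = Order.height U := Order.height_orderIso f U
  have h2 : Order.coheight (σ U) = Order.height U := h1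
  rw [← Module.length_quotient, ← Module.length_submodule, Module.length_eq_finrank,
    Module.length_eq_finrank] at h2
  have h3 : Module.finrank F (M ⧸ σ U) = Module.finrank F U := by exact_mod_cast h2
  have := Submodule.finrank_quotient_add_finrank (σ U)
  omega

lemma projPts_ncard {F V : Type*} [Field F] [Fintype F] [AddCommGroup V] [Module F V]
    [FiniteDimensional F V] (W : Submodule F V) :
    (projPts W).ncard = (Fintype.card F ^ Module.finrank F W - 1) / (Fintype.card F - 1) := by
  have e2 : {L : Submodule F W // Module.finrank F L = 1} ≃ projPts W :=
    { toFun := fun L => ⟨L.1.map W.subtype, by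
        rw [Submodule.finrank_map_subtype_eq]; exact L.2, Submodule.map_subtype_le _ _⟩
      invFun := fun L => ⟨L.1.comap W.subtype, by
        rw [(Submodule.comapSubtypeEquivOfLe L.2.2).finrank_eq]; exact L.2.1⟩
      left_inv := fun L => Subtype.ext
        (Submodule.comap_map_eq_of_injective W.injective_subtype _)
      right_inv := fun L => Subtype.ext (by
        simp [Submodule.map_comap_subtype, L.2.2]) }
  rw [← Nat.card_coe_set_eq, ← Nat.card_congr e2,
    ← Nat.card_congr (Projectivization.equivSubmodule F W), Projectivization.card'',
    Module.natCard_eq_pow_finrank (K := F), Nat.card_eq_fintype_card]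

/-- Let `U ∈ Gr_e(H)`, `W₁ ∈ C_U` and `W₂ ∈ Gr_{e+1}(H)`. Then
`|φ(W₁) ∩ [W₂]| = (q^e − 1)/(q − 1)` if and only if `σ(U) ⊆ W₂`, where
`φ(W₁) = [σ(U)] ∪ ([W₁] \ [H])`. -/
theorem stmt_16 {F : Type*} [Field F] [Fintype F]
    {V : Type*} [AddCommGroup V] [Module F V] [FiniteDimensional F V]
    (q e : ℕ) (hq : Fintype.card F = q) (he : 1 ≤ e)
    (hV : Module.finrank F V = 2 * e + 1)
    (H : Submodule F V) (hH : Module.finrank F ↥H = 2 * e)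
    (σ : Submodule F ↥H → Submodule F ↥H)
    (hσinv : ∀ U, σ (σ U) = U)
    (hσanti : ∀ U U' : Submodule F ↥H, U ≤ U' → σ U' ≤ σ U)
    (U : Submodule F ↥H) (hU : Module.finrank F ↥U = e)
    (W₁ : Submodule F V)
    (hW₁ : (Module.finrank F ↥W₁ = e + 1 ∧ ¬ W₁ ≤ H) ∧
      Submodule.comap H.subtype W₁ = U)
    (W₂ : Submodule F V) (hW₂ : Module.finrank F ↥W₂ = e + 1) (hW₂H : W₂ ≤ H) :
    (phiA H σ W₁ ∩ projPts W₂).ncard = (q ^ e - 1) / (q - 1) ↔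
      Submodule.map H.subtype (σ U) ≤ W₂ := by
  subst hq
  obtain ⟨-, hWU⟩ := hW₁
  set S := Submodule.map H.subtype (σ U) with hS
  have hdim : Module.finrank F S = e := by
    have := polarity_finrank σ hσinv hσanti U
    rw [hS, Submodule.finrank_map_subtype_eq]
    omega
  have hset : phiA H σ W₁ ∩ projPts W₂ = projPts (S ⊓ W₂) := by
    ext L
    simp only [phiA, hWU, ← hS, projPts, Set.mem_inter_iff, Set.mem_union, Set.mem_diff,
      Set.mem_setOf_eq, le_inf_iff]
    constructor
    · rintro ⟨h | h, h2⟩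
      · exact ⟨h.1, h.2, h2.2⟩
      · exact absurd ⟨h2.1, h2.2.trans hW₂H⟩ h.2
    · rintro ⟨h1, h2, h3⟩
      exact ⟨Or.inl ⟨h1, h2⟩, h1, h3⟩
  have hcard := projPts_ncard S
  rw [hdim] at hcard
  rw [hset, ← hcard]
  constructor
  · intro h
    have : Finite V := Module.finite_of_finite F
    have hsub : projPts (S ⊓ W₂) ⊆ projPts S := fun L hL => ⟨hL.1, hL.2.trans inf_le_left⟩
    have heq := Set.eq_of_subset_of_ncard_le hsub h.ge (Set.toFinite _)
    intro v hv
    by_cases h0 : v = 0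
    · simp [h0]
    have hm : F ∙ v ∈ projPts S :=
      ⟨finrank_span_singleton h0, (Submodule.span_singleton_le_iff_mem _ _).2 hv⟩
    rw [← heq] at hm
    exact ((Submodule.span_singleton_le_iff_mem _ _).1 hm.2).2
  · intro h
    rw [inf_eq_left.mpr h]
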